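/- arXiv:2301.10288 — 2 statements merged into one kernel-verified Lean document; each statement's English description precedes it below -/
import Mathlib

section
/- For every natural number m ≥ 1, ∑_{M} p^{|⋃_{Γ∈M} Γ|} ≤ c_m · n^{m·v_{G₀}} · p^{m·e_{G₀}} / Ψ_min^{m−1}, where the sum runs over all sets of connected copies M of size m and c_m := (v_{G₀}!)^{m−1} · 2^{(1/2)·m·(m−1)·e_{G₀}} · aut(G₀)^{−m}. -/
open scoped Classical

/-- `Γ ⊆ E(K_n)` is a copy of `G₀` if it is the image of the edge set of `G₀` under an
injection of the vertices. -/
noncomputable def copyFinset {V₀ : Type*} [Fintype V₀] [DecidableEq V₀]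
    (G₀ : SimpleGraph V₀) [DecidableRel G₀.Adj] (n : ℕ) :
    Finset (Finset (Sym2 (Fin n))) :=
  Finset.univ.filter (fun Γ => ∃ f : V₀ ↪ Fin n, Γ = G₀.edgeFinset.image (Sym2.map ⇑f))

/-- Ordered tuples `(Γ₁, …, Γ_m)` of copies of `G₀` in which each copy shares an edge with at
least one of its predecessors ("sets of connected copies of size m"). -/
noncomputable def connCopies {V₀ : Type*} [Fintype V₀] [DecidableEq V₀]
    (G₀ : SimpleGraph V₀) [DecidableRel G₀.Adj] (n m : ℕ) :
    Finset (Fin m → Finset (Sym2 (Fin n))) :=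
  Finset.univ.filter (fun M =>
    (∀ i, M i ∈ copyFinset G₀ n) ∧
    ∀ i : Fin m, 0 < (i : ℕ) → ∃ j : Fin m, (j : ℕ) < (i : ℕ) ∧ (M i ∩ M j).Nonempty)

/-- `Ψ_min = min{ n^{v_H} p^{e_H} : H ⊆ G₀ a subgraph with at least one edge }`. -/
noncomputable def PsiMin {V₀ : Type*} [Fintype V₀] [DecidableEq V₀]
    (G₀ : SimpleGraph V₀) [DecidableRel G₀.Adj] (n : ℕ) (p : ℝ) : ℝ :=
  sInf {x : ℝ | ∃ S ⊆ G₀.edgeFinset, S.Nonempty ∧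
    x = (n : ℝ) ^ (Finset.univ.filter (fun v : V₀ => ∃ e ∈ S, v ∈ e)).card * p ^ S.card}

namespace Aux15

noncomputable def img {V₀ : Type*} [Fintype V₀] [DecidableEq V₀]
    (G₀ : SimpleGraph V₀) [DecidableRel G₀.Adj] {n : ℕ} (f : V₀ ↪ Fin n) :
    Finset (Sym2 (Fin n)) := G₀.edgeFinset.image (Sym2.map ⇑f)

noncomputable def verts {n : ℕ} (I : Finset (Sym2 (Fin n))) : Finset (Fin n) :=
  Finset.univ.filter (fun v => ∃ e ∈ I, v ∈ e)

variable {V₀ : Type*} [Fintype V₀] [DecidableEq V₀]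
    (G₀ : SimpleGraph V₀) [DecidableRel G₀.Adj]

theorem mem_copy {n : ℕ} {Γ : Finset (Sym2 (Fin n))} :
    Γ ∈ copyFinset G₀ n ↔ ∃ f : V₀ ↪ Fin n, Γ = img G₀ f := by
  simp [copyFinset, img]

theorem card_img {n : ℕ} (f : V₀ ↪ Fin n) : (img G₀ f).card = G₀.edgeFinset.card :=
  Finset.card_image_of_injective _ (Sym2.map.injective f.injective)

theorem aut_pos : 0 < Nat.card (G₀ ≃g G₀) := by
  have : Finite (G₀ ≃g G₀) := DFunLike.finite _
  have : Nonempty (G₀ ≃g G₀) := ⟨RelIso.refl _⟩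
  exact Nat.card_pos

theorem img_aut {n : ℕ} (f : V₀ ↪ Fin n) (σ : G₀ ≃g G₀) :
    img G₀ (σ.toEquiv.toEmbedding.trans f) = img G₀ f := by
  apply Finset.eq_of_subset_of_card_le
  · intro e he
    simp only [img, Finset.mem_image, SimpleGraph.mem_edgeFinset] at he ⊢
    obtain ⟨a, ha, rfl⟩ := he
    refine ⟨Sym2.map σ a, ?_, ?_⟩
    · induction a using Sym2.ind with
      | _ x y =>
        have ha' : G₀.Adj x y := by simpa using ha
        simpa using σ.map_rel_iff.2 ha'
    · induction a using Sym2.ind with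
      | _ x y => simp
  · rw [card_img, card_img]

theorem aut_le {n : ℕ} (Γ : Finset (Sym2 (Fin n))) (h : Γ ∈ copyFinset G₀ n) :
    Nat.card (G₀ ≃g G₀) ≤ (Finset.univ.filter (fun f : V₀ ↪ Fin n => img G₀ f = Γ)).card := by
  obtain ⟨f, rfl⟩ := (mem_copy G₀).1 h
  have : Finite (G₀ ≃g G₀) := DFunLike.finite _
  have : Fintype (G₀ ≃g G₀) := Fintype.ofFinite _
  rw [Nat.card_eq_fintype_card, ← Finset.card_univ]
  apply Finset.card_le_card_of_injOn (fun σ => σ.toEquiv.toEmbedding.trans f)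
  · intro σ _
    simpa using img_aut G₀ f σ
  · intro σ _ τ _ h
    ext x
    have := DFunLike.congr_fun h x
    exact f.injective this

theorem aut_mul_le {n : ℕ} (S : Finset (Finset (Sym2 (Fin n)))) (h : S ⊆ copyFinset G₀ n) :
    Nat.card (G₀ ≃g G₀) * S.card ≤
      (Finset.univ.filter (fun f : V₀ ↪ Fin n => img G₀ f ∈ S)).card := by
  rw [Finset.card_eq_sum_card_fiberwise (f := img G₀) (t := S)
    (s := Finset.univ.filter (fun f : V₀ ↪ Fin n => img G₀ f ∈ S)) (by intro f hf; simpa using hf)]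
  rw [mul_comm, ← smul_eq_mul]
  apply Finset.card_nsmul_le_sum
  intro Γ hΓ
  refine (aut_le G₀ Γ (h hΓ)).trans (Finset.card_le_card ?_)
  intro f hf
  simp at hf ⊢
  exact ⟨by rw [hf]; exact hΓ, hf⟩

theorem card_fix {n : ℕ} (W : Finset (Fin n)) (g : W ↪ V₀) :
    (Finset.univ.filter (fun f : V₀ ↪ Fin n => ∀ w, f (g w) = w)).card
      ≤ n ^ (Fintype.card V₀ - W.card) := by
  have h1 : Fintype.card ({x : V₀ // x ∉ Finset.univ.map g} → Fin n)
      = n ^ (Fintype.card V₀ - W.card) := by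
    rw [Fintype.card_fun, Fintype.card_fin, Fintype.card_subtype_compl, Fintype.card_coe,
      Finset.card_map, Finset.card_univ, Fintype.card_coe]
  rw [← h1, ← Finset.card_univ]
  apply Finset.card_le_card_of_injOn (fun f x => f x.1) (fun _ _ => Finset.mem_coe.2 (Finset.mem_univ _))
  intro f hf f' hf' hff
  simp at hf hf'
  ext1 x
  by_cases hx : x ∈ Finset.univ.map g
  · simp at hx
    obtain ⟨a, ha, rfl⟩ := hx
    rw [hf, hf']
  · exact congrFun hff ⟨x, hx⟩

theorem card_range {n : ℕ} (W : Finset (Fin n)) :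
    (Finset.univ.filter (fun f : V₀ ↪ Fin n => ∀ w ∈ W, ∃ x, f x = w)).card
      ≤ (Fintype.card V₀).factorial * n ^ (Fintype.card V₀ - W.card) := by
  have hsub : (Finset.univ.filter (fun f : V₀ ↪ Fin n => ∀ w ∈ W, ∃ x, f x = w)) ⊆
      (Finset.univ : Finset (W ↪ V₀)).biUnion
        (fun g => Finset.univ.filter (fun f : V₀ ↪ Fin n => ∀ w, f (g w) = w)) := by
    intro f hf
    simp only [Finset.mem_filter, Finset.mem_univ, true_and, Finset.mem_biUnion] at hf ⊢
    choose g hg using hf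
    refine ⟨⟨fun w => g w.1 w.2, ?_⟩, fun w => hg w.1 w.2⟩
    intro a b hab
    have := congrArg f hab
    simp only [hg] at this
    exact Subtype.ext this
  refine (Finset.card_le_card hsub).trans ?_
  refine (Finset.card_biUnion_le_card_mul _ _ _ (fun g _ => card_fix W g)).trans ?_
  apply Nat.mul_le_mul_right
  rw [Finset.card_univ, Fintype.card_embedding_eq, Fintype.card_coe]
  by_cases h : W.card ≤ Fintype.card V₀
  · rw [← Nat.factorial_mul_descFactorial h]
    exact Nat.le_mul_of_pos_left _ (Nat.factorial_pos _)
  · rw [Nat.descFactorial_of_lt (by omega)]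
    exact Nat.zero_le _

theorem verts_range {n : ℕ} (I : Finset (Sym2 (Fin n))) (f : V₀ ↪ Fin n) (h : I ⊆ img G₀ f) :
    ∀ w ∈ verts I, ∃ x, f x = w := by
  intro w hw
  simp only [verts, Finset.mem_filter, Finset.mem_univ, true_and] at hw
  obtain ⟨e, he, hwe⟩ := hw
  have := h he
  simp only [img, Finset.mem_image] at this
  obtain ⟨a, ha, rfl⟩ := this
  rw [Sym2.mem_map] at hwe
  obtain ⟨x, _, hx⟩ := hwe
  exact ⟨x, hx⟩

theorem verts_card_le {n : ℕ} (I : Finset (Sym2 (Fin n))) (f : V₀ ↪ Fin n) (h : I ⊆ img G₀ f) :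
    (verts I).card ≤ Fintype.card V₀ := by
  have : verts I ⊆ Finset.univ.map f := by
    intro w hw
    simpa using verts_range G₀ I f h w hw
  simpa using Finset.card_le_card this

theorem psi_le {n : ℕ} {p : ℝ} (hp : 0 < p) (I : Finset (Sym2 (Fin n))) (hI : I.Nonempty)
    (f : V₀ ↪ Fin n) (h : I ⊆ img G₀ f) :
    PsiMin G₀ n p ≤ (n : ℝ) ^ (verts I).card * p ^ I.card := by
  apply csInf_le
  · refine ⟨0, ?_⟩
    rintro x ⟨S, _, _, rfl⟩
    positivity
  · have himg : (G₀.edgeFinset.filter (fun e => Sym2.map f e ∈ I)).image (Sym2.map f) = I := by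
      ext e
      simp only [Finset.mem_image, Finset.mem_filter]
      constructor
      · rintro ⟨a, ⟨_, ha⟩, rfl⟩
        exact ha
      · intro he
        have := h he
        simp only [img, Finset.mem_image] at this
        obtain ⟨a, ha, rfl⟩ := this
        exact ⟨a, ⟨ha, he⟩, rfl⟩
    refine ⟨G₀.edgeFinset.filter (fun e => Sym2.map f e ∈ I), Finset.filter_subset _ _, ?_, ?_⟩
    · rw [← himg] at hI
      exact Finset.image_nonempty.1 hI
    · have h1 : (G₀.edgeFinset.filter (fun e => Sym2.map f e ∈ I)).card = I.card := by
        conv_rhs => rw [← himg]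
        rw [Finset.card_image_of_injective _ (Sym2.map.injective f.injective)]
      rw [h1]
      congr 2
      set S := G₀.edgeFinset.filter (fun e => Sym2.map f e ∈ I)
      have h2 : verts I = (Finset.univ.filter (fun v : V₀ => ∃ e ∈ S, v ∈ e)).map f := by
        ext w
        simp only [verts, Finset.mem_filter, Finset.mem_univ, true_and, Finset.mem_map]
        rw [← himg]
        constructor
        · rintro ⟨e, he, hw⟩
          obtain ⟨a, ha, rfl⟩ := Finset.mem_image.1 he
          obtain ⟨x, hx, rfl⟩ := Sym2.mem_map.1 hw
          exact ⟨x, ⟨a, ha, hx⟩, rfl⟩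
        · rintro ⟨x, ⟨a, ha, hx⟩, rfl⟩
          exact ⟨_, Finset.mem_image_of_mem _ ha, Sym2.mem_map.2 ⟨x, hx, rfl⟩⟩
      rw [h2, Finset.card_map]

theorem psi_pos (hedge : G₀.edgeFinset.Nonempty) {n : ℕ} (hn : 0 < n) {p : ℝ} (hp : 0 < p)
    (hp1 : p < 1) : 0 < PsiMin G₀ n p := by
  refine lt_of_lt_of_le (pow_pos hp G₀.edgeFinset.card) ?_
  apply le_csInf
  · exact ⟨_, G₀.edgeFinset, Finset.Subset.refl _, hedge, rfl⟩
  · rintro x ⟨S, hS, _, rfl⟩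
    have h1 : (1 : ℝ) ≤ n := by exact_mod_cast hn
    calc p ^ G₀.edgeFinset.card ≤ p ^ S.card :=
          pow_le_pow_of_le_one hp.le hp1.le (Finset.card_le_card hS)
      _ = 1 * p ^ S.card := (one_mul _).symm
      _ ≤ _ := by
        apply mul_le_mul_of_nonneg_right (one_le_pow₀ h1) (by positivity)

/-- the contribution of one intersection pattern -/
theorem pattern (hedge : G₀.edgeFinset.Nonempty) {n : ℕ} (hn : 0 < n) {p : ℝ} (hp : 0 < p)
    (hp1 : p < 1) (I : Finset (Sym2 (Fin n))) (hI : I.Nonempty) (S : Finset (Finset (Sym2 (Fin n))))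
    (hS : S ⊆ copyFinset G₀ n) (hIS : ∀ Γ ∈ S, I ⊆ Γ) :
    (S.card : ℝ) * p ^ (G₀.edgeFinset.card - I.card) ≤
      (Fintype.card V₀).factorial / (Nat.card (G₀ ≃g G₀) : ℝ) *
        ((n : ℝ) ^ Fintype.card V₀ * p ^ G₀.edgeFinset.card / PsiMin G₀ n p) := by
  have hpsi := psi_pos G₀ hedge hn hp hp1
  have ha : (0 : ℝ) < Nat.card (G₀ ≃g G₀) := by exact_mod_cast aut_pos G₀
  have hn' : (0 : ℝ) < n := by exact_mod_cast hn
  rcases S.eq_empty_or_nonempty with rfl | ⟨Γ, hΓ⟩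
  · simp only [Finset.card_empty, Nat.cast_zero, zero_mul]
    positivity
  obtain ⟨f, rfl⟩ := (mem_copy G₀).1 (hS hΓ)
  have hIf := hIS _ hΓ
  have hw := verts_card_le G₀ I f hIf
  have hIc : I.card ≤ G₀.edgeFinset.card := by
    rw [← card_img G₀ f]; exact Finset.card_le_card hIf
  have hψ := psi_le G₀ hp I hI f hIf
  have hcount : Nat.card (G₀ ≃g G₀) * S.card ≤
      (Fintype.card V₀).factorial * n ^ (Fintype.card V₀ - (verts I).card) := by
    refine (aut_mul_le G₀ S hS).trans (le_trans (Finset.card_le_card ?_) (card_range (verts I)))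
    intro f' hf'
    simp only [Finset.mem_filter, Finset.mem_univ, true_and] at hf' ⊢
    exact verts_range G₀ I f' (hIS _ hf')
  have hcount' : (Nat.card (G₀ ≃g G₀) : ℝ) * S.card ≤
      (Fintype.card V₀).factorial * (n : ℝ) ^ (Fintype.card V₀ - (verts I).card) := by
    exact_mod_cast hcount
  rw [div_mul_div_comm, le_div_iff₀ (by positivity)]
  calc (S.card : ℝ) * p ^ (G₀.edgeFinset.card - I.card) *
        ((Nat.card (G₀ ≃g G₀) : ℝ) * PsiMin G₀ n p)
      = ((Nat.card (G₀ ≃g G₀) : ℝ) * S.card) * p ^ (G₀.edgeFinset.card - I.card) *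
          PsiMin G₀ n p := by ring
    _ ≤ ((Fintype.card V₀).factorial * (n : ℝ) ^ (Fintype.card V₀ - (verts I).card)) *
          p ^ (G₀.edgeFinset.card - I.card) * ((n : ℝ) ^ (verts I).card * p ^ I.card) := by
        gcongr
    _ = (Fintype.card V₀).factorial *
          (((n : ℝ) ^ (Fintype.card V₀ - (verts I).card) * (n : ℝ) ^ (verts I).card) *
          (p ^ (G₀.edgeFinset.card - I.card) * p ^ I.card)) := by ring
    _ = _ := by rw [← pow_add, ← pow_add, Nat.sub_add_cancel hw, Nat.sub_add_cancel hIc]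

theorem step (hedge : G₀.edgeFinset.Nonempty) {n : ℕ} (hn : 0 < n) {p : ℝ} (hp : 0 < p)
    (hp1 : p < 1) (U : Finset (Sym2 (Fin n))) :
    ∑ Γ ∈ (copyFinset G₀ n).filter (fun Γ => (Γ ∩ U).Nonempty), p ^ (Γ \ U).card ≤
      2 ^ U.card * ((Fintype.card V₀).factorial / (Nat.card (G₀ ≃g G₀) : ℝ) *
        ((n : ℝ) ^ Fintype.card V₀ * p ^ G₀.edgeFinset.card / PsiMin G₀ n p)) := by
  have hpsi := psi_pos G₀ hedge hn hp hp1
  rw [← Finset.sum_fiberwise_of_maps_to (g := fun Γ => Γ ∩ U) (t := U.powerset)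
    (by intro Γ _; exact Finset.mem_powerset.2 Finset.inter_subset_right)]
  have : (2 : ℝ) ^ U.card = U.powerset.card := by simp
  rw [this, ← nsmul_eq_mul]
  apply Finset.sum_le_card_nsmul
  intro I _
  by_cases hI : I.Nonempty
  · refine le_trans (le_of_eq ?_) (pattern G₀ hedge hn hp hp1 I hI
      (((copyFinset G₀ n).filter (fun Γ => (Γ ∩ U).Nonempty)).filter (fun Γ => Γ ∩ U = I)) ?_ ?_)
    · rw [← nsmul_eq_mul]
      apply Finset.sum_eq_card_nsmul
      intro Γ hΓ
      simp only [Finset.mem_filter] at hΓ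
      obtain ⟨⟨h1, _⟩, h3⟩ := hΓ
      obtain ⟨f, rfl⟩ := (mem_copy G₀).1 h1
      have := Finset.card_sdiff_add_card_inter (img G₀ f) U
      rw [h3, card_img] at this
      congr 1
      omega
    · intro Γ hΓ
      simp only [Finset.mem_filter] at hΓ
      exact hΓ.1.1
    · intro Γ hΓ
      simp only [Finset.mem_filter] at hΓ
      rw [← hΓ.2]
      exact Finset.inter_subset_left
  · rw [Finset.sum_eq_zero]
    · positivity
    · intro Γ hΓ
      simp only [Finset.mem_filter] at hΓ
      exact absurd (hΓ.2 ▸ hΓ.1.2) hI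

theorem union_card {n m : ℕ} (M : Fin m → Finset (Sym2 (Fin n)))
    (hM : ∀ i, M i ∈ copyFinset G₀ n) :
    (Finset.univ.biUnion M).card ≤ m * G₀.edgeFinset.card := by
  have := Finset.card_biUnion_le_card_mul Finset.univ M G₀.edgeFinset.card (by
    intro i _
    obtain ⟨f, hf⟩ := (mem_copy G₀).1 (hM i)
    rw [hf, card_img])
  simpa using this

theorem union_succ {n m : ℕ} (M : Fin (m + 1) → Finset (Sym2 (Fin n))) :
    Finset.univ.biUnion M = Finset.univ.biUnion (fun i : Fin m => M i.castSucc) ∪ M (Fin.last m) := by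
  ext e
  simp only [Finset.mem_biUnion, Finset.mem_univ, true_and, Finset.mem_union]
  constructor
  · rintro ⟨i, hi⟩
    induction i using Fin.lastCases with
    | last => exact Or.inr hi
    | cast j => exact Or.inl ⟨j, hi⟩
  · rintro (⟨i, hi⟩ | h)
    · exact ⟨_, hi⟩
    · exact ⟨_, h⟩

theorem sum_succ (hedge : G₀.edgeFinset.Nonempty) {n : ℕ} (hn : 0 < n) {p : ℝ} (hp : 0 < p)
    (hp1 : p < 1) (m : ℕ) (hm : 1 ≤ m) :
    ∑ M ∈ connCopies G₀ n (m + 1), p ^ (Finset.univ.biUnion M).card ≤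
      (∑ M ∈ connCopies G₀ n m, p ^ (Finset.univ.biUnion M).card) *
      (2 ^ (m * G₀.edgeFinset.card) * ((Fintype.card V₀).factorial / (Nat.card (G₀ ≃g G₀) : ℝ) *
        ((n : ℝ) ^ Fintype.card V₀ * p ^ G₀.edgeFinset.card / PsiMin G₀ n p))) := by
  have hpsi := psi_pos G₀ hedge hn hp hp1
  rw [← Finset.sum_fiberwise_of_maps_to
    (g := fun (M : Fin (m + 1) → Finset (Sym2 (Fin n))) (i : Fin m) => M i.castSucc)
    (t := connCopies G₀ n m)]
  swap
  · intro M hM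
    simp only [connCopies, Finset.mem_filter, Finset.mem_univ, true_and] at hM ⊢
    refine ⟨fun i => hM.1 _, fun i hi => ?_⟩
    obtain ⟨j, hj, hne⟩ := hM.2 i.castSucc (by simpa using hi)
    simp only [Fin.val_castSucc] at hj
    exact ⟨⟨j, by omega⟩, hj, hne⟩
  rw [Finset.sum_mul]
  apply Finset.sum_le_sum
  intro M' hM'
  simp only [connCopies, Finset.mem_filter, Finset.mem_univ, true_and] at hM'
  set U := Finset.univ.biUnion M' with hU
  set F := (connCopies G₀ n (m + 1)).filter (fun M => (fun i : Fin m => M i.castSucc) = M') with hF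
  have hmem : ∀ M ∈ F, (fun i : Fin m => M i.castSucc) = M' := fun M hM =>
    (Finset.mem_filter.1 hM).2
  have h1 : ∑ M ∈ F, p ^ (Finset.univ.biUnion M).card
      = p ^ U.card * ∑ M ∈ F, p ^ (M (Fin.last m) \ U).card := by
    rw [Finset.mul_sum]
    apply Finset.sum_congr rfl
    intro M hM
    rw [union_succ, hmem M hM, ← hU, ← pow_add, Finset.card_union, ]
    congr 1
    have := Finset.card_sdiff_add_card_inter (M (Fin.last m)) U
    rw [Finset.inter_comm] at this
    omega
  have hinj : Set.InjOn (fun M : Fin (m + 1) → Finset (Sym2 (Fin n)) => M (Fin.last m)) F := by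
    intro M hM N hN h
    have h2 := (hmem M hM).trans (hmem N hN).symm
    funext i
    induction i using Fin.lastCases with
    | last => exact h
    | cast j => exact congrFun h2 j
  rw [h1]
  apply mul_le_mul_of_nonneg_left _ (by positivity)
  rw [← Finset.sum_image (f := fun Γ => p ^ (Γ \ U).card) hinj]
  refine (Finset.sum_le_sum_of_subset_of_nonneg (t := (copyFinset G₀ n).filter
    (fun Γ => (Γ ∩ U).Nonempty)) ?_ (fun _ _ _ => by positivity)).trans ?_
  · intro Γ hΓ
    obtain ⟨M, hM, rfl⟩ := Finset.mem_image.1 hΓ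
    have hc := (Finset.mem_filter.1 hM).1
    simp only [connCopies, Finset.mem_filter, Finset.mem_univ, true_and] at hc ⊢
    refine ⟨hc.1 _, ?_⟩
    obtain ⟨j, hj, e, he⟩ := hc.2 (Fin.last m) (by simp; omega)
    rw [Finset.mem_inter] at he
    refine ⟨e, Finset.mem_inter.2 ⟨he.1, ?_⟩⟩
    rw [hU, ← hmem M hM]
    exact Finset.mem_biUnion.2 ⟨⟨j, by simpa using hj⟩, Finset.mem_univ _, he.2⟩
  · refine (step G₀ hedge hn hp hp1 U).trans ?_
    apply mul_le_mul_of_nonneg_right _ (by positivity)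
    exact pow_le_pow_right₀ (by norm_num) (union_card G₀ M' hM'.1)

theorem base {n : ℕ} {p : ℝ} (hp : 0 < p) :
    ∑ M ∈ connCopies G₀ n 1, p ^ (Finset.univ.biUnion M).card ≤
      (n : ℝ) ^ Fintype.card V₀ * p ^ G₀.edgeFinset.card / (Nat.card (G₀ ≃g G₀) : ℝ) := by
  have ha : (0 : ℝ) < Nat.card (G₀ ≃g G₀) := by exact_mod_cast aut_pos G₀
  have h1 : ∑ M ∈ connCopies G₀ n 1, p ^ (Finset.univ.biUnion M).card
      = (connCopies G₀ n 1).card * p ^ G₀.edgeFinset.card := by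
    rw [← nsmul_eq_mul]
    apply Finset.sum_eq_card_nsmul
    intro M hM
    simp only [connCopies, Finset.mem_filter, Finset.mem_univ, true_and] at hM
    obtain ⟨f, hf⟩ := (mem_copy G₀).1 (hM.1 0)
    simp [hf, card_img]
  have h2 : (connCopies G₀ n 1).card ≤ (copyFinset G₀ n).card := by
    apply Finset.card_le_card_of_injOn (fun M => M 0)
    · intro M hM
      simp only [connCopies, Finset.coe_filter, Set.mem_setOf_eq, Finset.mem_univ, true_and] at hM
      exact hM.1 0
    · intro M _ N _ h
      funext i
      rw [Subsingleton.elim i 0]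
      exact h
  have h3 : Nat.card (G₀ ≃g G₀) * (copyFinset G₀ n).card ≤ n ^ Fintype.card V₀ := by
    refine (aut_mul_le G₀ _ (Finset.Subset.refl _)).trans ((Finset.card_le_univ _).trans ?_)
    rw [Fintype.card_embedding_eq, Fintype.card_fin]
    exact Nat.descFactorial_le_pow _ _
  have h4 : (connCopies G₀ n 1).card * Nat.card (G₀ ≃g G₀) ≤ n ^ Fintype.card V₀ :=
    le_trans (by rw [mul_comm]; exact Nat.mul_le_mul_left _ h2) h3
  have h5 : ((connCopies G₀ n 1).card : ℝ) * Nat.card (G₀ ≃g G₀) ≤ (n : ℝ) ^ Fintype.card V₀ := by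
    exact_mod_cast h4
  rw [h1, le_div_iff₀ ha]
  calc _ = ((connCopies G₀ n 1).card : ℝ) * Nat.card (G₀ ≃g G₀) * p ^ G₀.edgeFinset.card := by ring
    _ ≤ _ := by gcongr

end Aux15

/-- for every `m ≥ 1`,
`∑_M p^{|⋃_{Γ∈M} Γ|} ≤ c_m · n^{m·v_{G₀}} · p^{m·e_{G₀}} / Ψ_min^{m−1}`, the sum running over all
sets of connected copies of size `m`, with
`c_m = (v_{G₀}!)^{m−1} · 2^{(1/2)m(m−1)e_{G₀}} · aut(G₀)^{−m}`. -/
theorem stmt_15 {V₀ : Type*} [Fintype V₀] [DecidableEq V₀]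
    (G₀ : SimpleGraph V₀) [DecidableRel G₀.Adj]
    (hedge : G₀.edgeFinset.Nonempty)
    (hniso : ∀ v : V₀, ∃ w, G₀.Adj v w)
    (n : ℕ) (p : ℝ) (hp : 0 < p) (hp1 : p < 1)
    (m : ℕ) (hm : 1 ≤ m) :
    ∑ M ∈ connCopies G₀ n m, p ^ (Finset.univ.biUnion M).card ≤
      ((Fintype.card V₀).factorial : ℝ) ^ (m - 1) *
          2 ^ (m * (m - 1) / 2 * G₀.edgeFinset.card) / (Nat.card (G₀ ≃g G₀) : ℝ) ^ m *
        ((n : ℝ) ^ (m * Fintype.card V₀) * p ^ (m * G₀.edgeFinset.card) /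
          PsiMin G₀ n p ^ (m - 1)) := by
  have ha : (0 : ℝ) < Nat.card (G₀ ≃g G₀) := by exact_mod_cast Aux15.aut_pos G₀
  rcases Nat.eq_zero_or_pos n with hn | hn
  · subst hn
    have hpsi : 0 ≤ PsiMin G₀ 0 p := by
      apply Real.sInf_nonneg
      rintro x ⟨S, _, _, rfl⟩
      positivity
    rw [Finset.sum_eq_zero]
    · positivity
    · intro M hM
      simp only [connCopies, Finset.mem_filter, Finset.mem_univ, true_and] at hM
      obtain ⟨f, _⟩ := (Aux15.mem_copy G₀).1 (hM.1 ⟨0, hm⟩)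
      obtain ⟨e, _⟩ := hedge
      induction e using Sym2.ind with
      | _ x y => exact (f x).elim0
  have hpsi := Aux15.psi_pos G₀ hedge hn hp hp1
  induction m, hm using Nat.le_induction with
  | base =>
    refine (Aux15.base G₀ hp).trans (le_of_eq ?_)
    simp
    field_simp
  | succ k hk ih =>
    refine (Aux15.sum_succ G₀ hedge hn hp hp1 k hk).trans ?_
    refine (mul_le_mul_of_nonneg_right ih (by positivity)).trans (le_of_eq ?_)
    obtain ⟨j, rfl⟩ : ∃ j, k = j + 1 := ⟨k - 1, by omega⟩
    have e1 : (j + 1 + 1) * (j + 1) / 2 = (j + 1) * j / 2 + (j + 1) := by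
      have : (j + 1 + 1) * (j + 1) = (j + 1) * j + (j + 1) * 2 := by ring
      rw [this, Nat.add_mul_div_right _ _ (by norm_num)]
    simp only [Nat.add_sub_cancel]
    rw [e1]
    generalize (j + 1) * j / 2 = t
    field_simp
    ring
end

section
/- For all natural numbers m, m̂ ≥ 1, setting m̄ := m + m̂, one has ∑_{M, M̂} p^{|⋃_{Γ∈M∪M̂} Γ|} ≤ c_{m̄} · n^{m̄·v_{G₀}} · p^{m̄·e_{G₀}} / ( Ψ_min^{m̄−2} · min{Ψ_min, 1} ), where the sum runs over all pairs consisting of a set of connected copies M of size m and a set of connected copies M̂ of size m̂, and c_{m̄} := (v_{G₀}!)^{m̄−1} · 2^{(1/2)·m̄·(m̄−1)·e_{G₀}} · aut(G₀)^{−m̄}. -/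
open scoped Classical

namespace S16

set_option linter.unusedSectionVars false
set_option linter.style.haveILetI false

variable {V₀ : Type*} [Fintype V₀] [DecidableEq V₀] (G₀ : SimpleGraph V₀) [DecidableRel G₀.Adj]

/-- image copy -/
noncomputable def img {n : ℕ} (f : V₀ ↪ Fin n) : Finset (Sym2 (Fin n)) :=
  G₀.edgeFinset.image (Sym2.map ⇑f)

/-- vertices of an edge set -/
noncomputable def vert {n : ℕ} (T : Finset (Sym2 (Fin n))) : Finset (Fin n) :=
  Finset.univ.filter (fun v => ∃ e ∈ T, v ∈ e)

lemma mem_copy {n : ℕ} {Γ : Finset (Sym2 (Fin n))} :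
    Γ ∈ copyFinset G₀ n ↔ ∃ f : V₀ ↪ Fin n, Γ = img G₀ f := by
  simp [copyFinset, img]

lemma card_img {n : ℕ} (f : V₀ ↪ Fin n) : (img G₀ f).card = G₀.edgeFinset.card :=
  Finset.card_image_of_injective _ (Sym2.map.injective f.injective)

lemma vert_sub_range {n : ℕ} (f : V₀ ↪ Fin n) (T : Finset (Sym2 (Fin n))) (hT : T ⊆ img G₀ f)
    (w : vert T) : ∃ v, f v = w := by
  obtain ⟨w, hw⟩ := w
  simp only [vert, Finset.mem_filter, Finset.mem_univ, true_and] at hw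
  obtain ⟨e, he, hwe⟩ := hw
  obtain ⟨e', _, rfl⟩ := Finset.mem_image.1 (hT he)
  obtain ⟨v, _, hv⟩ := Sym2.mem_map.1 hwe
  exact ⟨v, hv⟩

lemma count {n : ℕ} (T : Finset (Sym2 (Fin n))) :
    (Finset.univ.filter (fun f : V₀ ↪ Fin n => T ⊆ img G₀ f)).card * n ^ (vert T).card
      ≤ (Fintype.card V₀).factorial * n ^ Fintype.card V₀ := by
  have key : Fintype.card ({f : V₀ ↪ Fin n // T ⊆ img G₀ f} × (vert T → Fin n))
      ≤ Fintype.card ((vert T ↪ V₀) × (V₀ → Fin n)) := by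
    choose h hh using fun (f : {f : V₀ ↪ Fin n // T ⊆ img G₀ f}) => vert_sub_range G₀ f.1 T f.2
    have hinj : ∀ f, Function.Injective (h f) := by
      intro f a b hab
      have h1 := hh f a
      have h2 := hh f b
      rw [hab, h2] at h1
      exact (Subtype.ext h1).symm
    refine Fintype.card_le_of_injective
      (fun x => (⟨h x.1, hinj x.1⟩, Function.extend (h x.1) x.2 x.1.1)) ?_
    rintro ⟨f, g⟩ ⟨f', g'⟩ hx
    simp only [Prod.mk.injEq, Function.Embedding.mk.injEq] at hx
    obtain ⟨hx1, hx2⟩ := hx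
    rw [← hx1] at hx2
    have hg : g = g' := by
      funext w
      have := congrFun hx2 (h f w)
      rwa [(hinj f).extend_apply, (hinj f).extend_apply] at this
    have hf : f = f' := by
      apply Subtype.ext
      ext v
      by_cases hv : ∃ w, h f w = v
      · obtain ⟨w, rfl⟩ := hv
        rw [hh f w, hx1, hh f' w]
      · have := congrFun hx2 v
        rw [Function.extend_apply' _ _ _ hv, Function.extend_apply' _ _ _ hv] at this
        rw [this]
    rw [hg, hf]
  rw [Fintype.card_prod, Fintype.card_prod, Fintype.card_fun, Fintype.card_fun,
    Fintype.card_embedding_eq, Fintype.card_fin, Fintype.card_coe, Fintype.card_subtype] at key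
  refine key.trans (Nat.mul_le_mul_right _ ?_)
  rcases le_or_gt (vert T).card (Fintype.card V₀) with hle | hlt
  · rw [← Nat.factorial_mul_descFactorial hle]
    exact Nat.le_mul_of_pos_left _ (Nat.factorial_pos _)
  · rw [Nat.descFactorial_of_lt hlt]; exact Nat.zero_le _

lemma psi_mem_le {n : ℕ} {p : ℝ} (hp : 0 < p) (S : Finset (Sym2 V₀)) (hS : S ⊆ G₀.edgeFinset)
    (hne : S.Nonempty) : PsiMin G₀ n p ≤
      (n : ℝ) ^ (Finset.univ.filter (fun v : V₀ => ∃ e ∈ S, v ∈ e)).card * p ^ S.card := by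
  refine csInf_le ⟨0, ?_⟩ ⟨S, hS, hne, rfl⟩
  rintro x ⟨S, _, _, rfl⟩
  positivity

lemma psi_pos {n : ℕ} {p : ℝ} (hp : 0 < p) (hn : 0 < n) (hedge : G₀.edgeFinset.Nonempty) :
    0 < PsiMin G₀ n p := by
  have : PsiMin G₀ n p ∈ {x : ℝ | ∃ S ⊆ G₀.edgeFinset, S.Nonempty ∧
    x = (n : ℝ) ^ (Finset.univ.filter (fun v : V₀ => ∃ e ∈ S, v ∈ e)).card * p ^ S.card} := by
    refine Set.Nonempty.csInf_mem ⟨_, G₀.edgeFinset, subset_rfl, hedge, rfl⟩ ?_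
    refine (Set.finite_range (fun S : Finset (Sym2 V₀) => (n : ℝ) ^ (Finset.univ.filter
      (fun v : V₀ => ∃ e ∈ S, v ∈ e)).card * p ^ S.card)).subset ?_
    rintro x ⟨S, _, _, rfl⟩
    exact ⟨S, rfl⟩
  obtain ⟨S, _, _, h⟩ := this
  rw [h]; positivity

lemma psi_le {n : ℕ} {p : ℝ} (hp : 0 < p) (f : V₀ ↪ Fin n) (T : Finset (Sym2 (Fin n)))
    (hT : T ⊆ img G₀ f) (hne : T.Nonempty) :
    PsiMin G₀ n p ≤ (n : ℝ) ^ (vert T).card * p ^ T.card := by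
  obtain ⟨S, hS, rfl⟩ := Finset.subset_image_iff.1 hT
  have h := psi_mem_le G₀ (n := n) hp S (by exact_mod_cast hS) (by simpa using hne)
  rw [Finset.card_image_of_injective _ (Sym2.map.injective f.injective)]
  have : vert (S.image (Sym2.map ⇑f)) =
      (Finset.univ.filter (fun v : V₀ => ∃ e ∈ S, v ∈ e)).map f := by
    ext w
    simp only [vert, Finset.mem_filter, Finset.mem_univ, true_and, Finset.mem_image,
      Finset.mem_map]
    constructor
    · rintro ⟨_, ⟨e, he, rfl⟩, hw⟩
      obtain ⟨v, hv, rfl⟩ := Sym2.mem_map.1 hw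
      exact ⟨v, ⟨e, he, hv⟩, rfl⟩
    · rintro ⟨v, ⟨e, he, hv⟩, rfl⟩
      exact ⟨_, ⟨e, he, rfl⟩, Sym2.mem_map.2 ⟨v, hv, rfl⟩⟩
  rw [this, Finset.card_map]
  exact h

lemma aut_le {n : ℕ} (Γ : Finset (Sym2 (Fin n))) (hΓ : Γ ∈ copyFinset G₀ n) :
    Nat.card (G₀ ≃g G₀) ≤ (Finset.univ.filter (fun f : V₀ ↪ Fin n => img G₀ f = Γ)).card := by
  obtain ⟨f, rfl⟩ := (mem_copy G₀).1 hΓ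
  rw [← Fintype.card_subtype, ← Nat.card_eq_fintype_card]
  have him : ∀ σ : G₀ ≃g G₀, img G₀ (σ.toEquiv.toEmbedding.trans f) = img G₀ f := by
    intro σ
    apply Finset.eq_of_subset_of_card_le
    · intro e he
      obtain ⟨e', he', rfl⟩ := Finset.mem_image.1 he
      refine Finset.mem_image.2 ⟨Sym2.map σ e', ?_, ?_⟩
      · induction e' using Sym2.ind with
        | _ x y =>
          rw [SimpleGraph.mem_edgeFinset, SimpleGraph.mem_edgeSet] at he'
          rw [Sym2.map_mk, SimpleGraph.mem_edgeFinset, SimpleGraph.mem_edgeSet]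
          exact σ.map_rel_iff.2 he'
      · rw [Sym2.map_map]; rfl
    · rw [card_img, card_img]
  refine Nat.card_le_card_of_injective
    (fun σ : G₀ ≃g G₀ => (⟨σ.toEquiv.toEmbedding.trans f, him σ⟩ :
      {g : V₀ ↪ Fin n // img G₀ g = img G₀ f})) ?_
  intro σ τ h
  ext v
  have h1 := congrArg Subtype.val h
  have h2 := DFunLike.congr_fun h1 v
  exact f.injective h2

lemma aut_pos : 0 < Nat.card (G₀ ≃g G₀) := by
  haveI : Finite (G₀ ≃g G₀) := Finite.of_injective (fun σ : G₀ ≃g G₀ => (σ : V₀ → V₀))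
    (fun σ τ h => by ext v; exact congrFun h v)
  haveI : Nonempty (G₀ ≃g G₀) := ⟨RelIso.refl _⟩
  exact Nat.card_pos

lemma sum_copy {n : ℕ} (F : Finset (Finset (Sym2 (Fin n)))) (hF : F ⊆ copyFinset G₀ n)
    (φ : Finset (Sym2 (Fin n)) → ℝ) (hφ : ∀ Γ, 0 ≤ φ Γ) :
    (∑ Γ ∈ F, φ Γ) * Nat.card (G₀ ≃g G₀) ≤
      ∑ f ∈ Finset.univ.filter (fun f : V₀ ↪ Fin n => img G₀ f ∈ F), φ (img G₀ f) := by
  rw [Finset.sum_mul, ← Finset.sum_fiberwise_of_maps_to (t := F) (g := fun f => img G₀ f)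
    (by intro f hf; exact (Finset.mem_filter.1 hf).2)]
  refine Finset.sum_le_sum fun Γ hΓ => ?_
  rw [Finset.filter_filter]
  have : ∀ f ∈ Finset.univ.filter (fun f : V₀ ↪ Fin n => img G₀ f ∈ F ∧ img G₀ f = Γ),
      φ (img G₀ f) = φ Γ := by
    intro f hf; rw [(Finset.mem_filter.1 hf).2.2]
  rw [Finset.sum_congr rfl this, Finset.sum_const, nsmul_eq_mul, mul_comm]
  refine mul_le_mul_of_nonneg_right ?_ (hφ _)
  have h2 : Finset.univ.filter (fun f : V₀ ↪ Fin n => img G₀ f ∈ F ∧ img G₀ f = Γ) =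
      Finset.univ.filter (fun f : V₀ ↪ Fin n => img G₀ f = Γ) := by
    ext f
    simp only [Finset.mem_filter, Finset.mem_univ, true_and]
    exact ⟨fun h => h.2, fun h => ⟨h ▸ hΓ, h⟩⟩
  rw [h2]
  exact_mod_cast aut_le G₀ Γ (hF hΓ)

lemma step {n : ℕ} {p : ℝ} (hp : 0 < p) (U : Finset (Sym2 (Fin n)))
    (F : Finset (Finset (Sym2 (Fin n)))) (hF : F ⊆ copyFinset G₀ n) (D : ℝ) (hD0 : 0 < D)
    (hD : ∀ Γ ∈ F, D ≤ (n : ℝ) ^ (vert (Γ ∩ U)).card * p ^ (Γ ∩ U).card) :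
    ∑ Γ ∈ F, p ^ (Γ \ U).card ≤
      (Fintype.card V₀).factorial * 2 ^ U.card *
        ((n : ℝ) ^ Fintype.card V₀ * p ^ G₀.edgeFinset.card) /
          (Nat.card (G₀ ≃g G₀) * D) := by
  have hA : (0 : ℝ) < Nat.card (G₀ ≃g G₀) := by exact_mod_cast aut_pos G₀
  rw [le_div_iff₀ (by positivity), ← mul_assoc]
  have h1 := sum_copy G₀ F hF (fun Γ => p ^ (Γ \ U).card) (fun Γ => by positivity)
  refine (mul_le_mul_of_nonneg_right h1 hD0.le).trans ?_
  rw [← Finset.sum_fiberwise_of_maps_to (t := U.powerset) (g := fun f => img G₀ f ∩ U)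
    (by intro f hf; exact Finset.mem_powerset.2 Finset.inter_subset_right), Finset.sum_mul]
  have hT : ∀ T ∈ U.powerset,
      (∑ f ∈ (Finset.univ.filter (fun f : V₀ ↪ Fin n => img G₀ f ∈ F)).filter
        (fun f => img G₀ f ∩ U = T), p ^ (img G₀ f \ U).card) * D ≤
      (Fintype.card V₀).factorial * ((n : ℝ) ^ Fintype.card V₀ * p ^ G₀.edgeFinset.card) := by
    intro T _
    have hb : ∀ f ∈ (Finset.univ.filter (fun f : V₀ ↪ Fin n => img G₀ f ∈ F)).filter
        (fun f => img G₀ f ∩ U = T),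
        p ^ (img G₀ f \ U).card * D ≤ (n : ℝ) ^ (vert T).card * p ^ G₀.edgeFinset.card := by
      intro f hf
      simp only [Finset.mem_filter, Finset.mem_univ, true_and] at hf
      have h := hD _ hf.1
      have hc := Finset.card_sdiff_add_card_inter (img G₀ f) U
      rw [hf.2] at h hc
      rw [card_img] at hc
      calc _ ≤ p ^ (img G₀ f \ U).card * ((n : ℝ) ^ (vert T).card * p ^ T.card) := by gcongr
        _ = _ := by rw [← hc, pow_add]; ring
    rw [Finset.sum_mul]
    refine (Finset.sum_le_card_nsmul _ _ _ hb).trans ?_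
    rw [nsmul_eq_mul, ← mul_assoc, ← mul_assoc]
    refine mul_le_mul_of_nonneg_right ?_ (by positivity)
    have hc := count G₀ T
    have hs : ((Finset.univ.filter (fun f : V₀ ↪ Fin n => img G₀ f ∈ F)).filter
        (fun f => img G₀ f ∩ U = T)).card ≤
        (Finset.univ.filter (fun f : V₀ ↪ Fin n => T ⊆ img G₀ f)).card := by
      apply Finset.card_le_card
      intro f hf
      simp only [Finset.mem_filter, Finset.mem_univ, true_and] at hf ⊢
      rw [← hf.2]; exact Finset.inter_subset_left
    exact_mod_cast (Nat.mul_le_mul_right _ hs).trans hc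
  refine (Finset.sum_le_card_nsmul _ _ _ hT).trans (le_of_eq ?_)
  rw [Finset.card_powerset, nsmul_eq_mul]
  push_cast; ring

lemma step_zero {n : ℕ} {p : ℝ} (hp : 0 < p) :
    ∑ Γ ∈ copyFinset G₀ n, p ^ Γ.card ≤
      ((n : ℝ) ^ Fintype.card V₀ * p ^ G₀.edgeFinset.card) / Nat.card (G₀ ≃g G₀) := by
  have hA : (0 : ℝ) < Nat.card (G₀ ≃g G₀) := by exact_mod_cast aut_pos G₀
  rw [le_div_iff₀ hA]
  refine (sum_copy G₀ _ subset_rfl (fun Γ => p ^ Γ.card) (fun Γ => by positivity)).trans ?_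
  refine (Finset.sum_le_card_nsmul _ _ (p ^ G₀.edgeFinset.card)
    (fun f _ => by rw [card_img])).trans ?_
  rw [nsmul_eq_mul]
  refine mul_le_mul_of_nonneg_right ?_ (by positivity)
  have : (Finset.univ.filter (fun f : V₀ ↪ Fin n => img G₀ f ∈ copyFinset G₀ n)).card ≤
      n ^ Fintype.card V₀ := by
    refine (Finset.card_le_univ _).trans ?_
    rw [Fintype.card_embedding_eq, Fintype.card_fin]
    exact Nat.descFactorial_le_pow _ _
  exact_mod_cast this

/-- the partial sum -/
noncomputable def S (n : ℕ) (p : ℝ) (W : Finset (Sym2 (Fin n))) (m : ℕ) : ℝ :=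
  ∑ M ∈ connCopies G₀ n m, p ^ (W ∪ Finset.univ.biUnion M).card

lemma card_biUnion {n m : ℕ} (M : Fin m → Finset (Sym2 (Fin n))) (hM : M ∈ connCopies G₀ n m) :
    (Finset.univ.biUnion M).card ≤ m * G₀.edgeFinset.card := by
  have h := (Finset.mem_filter.1 hM).2.1
  refine (Finset.card_biUnion_le_card_mul _ _ G₀.edgeFinset.card fun i _ => ?_).trans (by simp)
  obtain ⟨f, hf⟩ := (mem_copy G₀).1 (h i)
  rw [hf, card_img]

lemma S_one {n : ℕ} {p : ℝ} (W : Finset (Sym2 (Fin n))) :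
    S G₀ n p W 1 = p ^ W.card * ∑ Γ ∈ copyFinset G₀ n, p ^ (Γ \ W).card := by
  unfold S
  rw [Finset.mul_sum]
  refine Finset.sum_bij' (fun M _ => M 0) (fun Γ _ => fun _ => Γ) ?_ ?_ ?_ ?_ ?_
  · intro M hM; exact (Finset.mem_filter.1 hM).2.1 0
  · intro Γ hΓ
    refine Finset.mem_filter.2 ⟨Finset.mem_univ _, fun _ => hΓ, fun i hi => ?_⟩
    omega
  · intro M _; funext i; rw [Subsingleton.elim i 0]
  · intro Γ _; rfl
  · intro M _
    rw [← pow_add]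
    congr 1
    have : (Finset.univ.biUnion M) = M 0 := by ext; simp
    rw [this, ← Finset.union_sdiff_self_eq_union,
      Finset.card_union_of_disjoint Finset.disjoint_sdiff]

lemma S_succ {n : ℕ} {p : ℝ} (hp : 0 < p) (hpsi : 0 < PsiMin G₀ n p) (W : Finset (Sym2 (Fin n)))
    (k : ℕ) (hW : W.card ≤ k * G₀.edgeFinset.card) (m : ℕ) :
    S G₀ n p W (m + 2) ≤ S G₀ n p W (m + 1) *
      ((Fintype.card V₀).factorial * 2 ^ ((k + (m + 1)) * G₀.edgeFinset.card) *
        ((n : ℝ) ^ Fintype.card V₀ * p ^ G₀.edgeFinset.card) /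
          (Nat.card (G₀ ≃g G₀) * PsiMin G₀ n p)) := by
  have hA : (0 : ℝ) < Nat.card (G₀ ≃g G₀) := by exact_mod_cast aut_pos G₀
  let UU : (Fin (m+1) → Finset (Sym2 (Fin n))) → Finset (Sym2 (Fin n)) :=
    fun M => W ∪ Finset.univ.biUnion M
  let FF : (Fin (m+1) → Finset (Sym2 (Fin n))) → Finset (Finset (Sym2 (Fin n))) :=
    fun M => (copyFinset G₀ n).filter (fun Γ => (Γ ∩ UU M).Nonempty)
  have h1 : S G₀ n p W (m + 2) ≤ ∑ M ∈ connCopies G₀ n (m + 1), ∑ Γ ∈ FF M,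
      p ^ (UU M ∪ Γ).card := by
    rw [Finset.sum_sigma']
    unfold S
    have hmem : ∀ M ∈ connCopies G₀ n (m + 2),
        (⟨Fin.init M, M (Fin.last _)⟩ : Σ _ : (Fin (m+1) → Finset (Sym2 (Fin n))),
          Finset (Sym2 (Fin n))) ∈ (connCopies G₀ n (m + 1)).sigma FF := by
      intro M hM
      obtain ⟨hc, hconn⟩ := (Finset.mem_filter.1 hM).2
      refine Finset.mem_sigma.2 ⟨Finset.mem_filter.2 ⟨Finset.mem_univ _, fun i => hc _, ?_⟩,
        Finset.mem_filter.2 ⟨hc _, ?_⟩⟩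
      · intro i hi
        obtain ⟨j, hj, hne⟩ := hconn i.castSucc (by simpa using hi)
        have hj' : (j : ℕ) < i := by simpa using hj
        exact ⟨⟨j, by omega⟩, hj', hne⟩
      · obtain ⟨j, hj, hne⟩ := hconn (Fin.last _) (by simp)
        have hj' : (j : ℕ) < m + 1 := by simpa using hj
        refine hne.mono (Finset.inter_subset_inter_left ?_)
        refine subset_trans ?_ Finset.subset_union_right
        exact Finset.subset_biUnion_of_mem (Fin.init M) (Finset.mem_univ (⟨j, hj'⟩ : Fin (m+1)))
    have hinj : Set.InjOn (fun M : Fin (m+2) → Finset (Sym2 (Fin n)) =>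
        (⟨Fin.init M, M (Fin.last _)⟩ : Σ _ : (Fin (m+1) → Finset (Sym2 (Fin n))),
          Finset (Sym2 (Fin n)))) (connCopies G₀ n (m + 2)) := by
      intro M _ M' _ h
      simp only [Sigma.mk.injEq, heq_eq_eq] at h
      rw [← Fin.snoc_init_self M, ← Fin.snoc_init_self M', h.1, h.2]
    calc _ = ∑ x ∈ (connCopies G₀ n (m + 2)).image (fun M => (⟨Fin.init M, M (Fin.last _)⟩ :
              Σ _ : (Fin (m+1) → Finset (Sym2 (Fin n))), Finset (Sym2 (Fin n)))),
              p ^ (UU x.1 ∪ x.2).card := by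
          rw [Finset.sum_image hinj]
          refine Finset.sum_congr rfl fun M _ => ?_
          congr 2
          ext e
          simp only [UU, Finset.mem_union, Finset.mem_biUnion, Finset.mem_univ, true_and,
            Fin.exists_fin_succ', Fin.init]
          tauto
      _ ≤ _ := by
          refine Finset.sum_le_sum_of_subset_of_nonneg ?_ (fun _ _ _ => by positivity)
          exact Finset.image_subset_iff.2 hmem
  refine h1.trans ?_
  unfold S
  rw [Finset.sum_mul]
  refine Finset.sum_le_sum fun M hM => ?_
  have h2 : ∑ Γ ∈ FF M, p ^ (UU M ∪ Γ).card = p ^ (UU M).card * ∑ Γ ∈ FF M, p ^ (Γ \ UU M).card := by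
    rw [Finset.mul_sum]
    refine Finset.sum_congr rfl fun Γ _ => ?_
    rw [← pow_add, ← Finset.union_sdiff_self_eq_union,
      Finset.card_union_of_disjoint Finset.disjoint_sdiff]
  rw [h2]
  refine mul_le_mul_of_nonneg_left ?_ (by positivity)
  refine (step G₀ hp (UU M) (FF M) (Finset.filter_subset _ _) (PsiMin G₀ n p) hpsi ?_).trans ?_
  · intro Γ hΓ
    obtain ⟨hΓ1, hΓ2⟩ := Finset.mem_filter.1 hΓ
    obtain ⟨f, rfl⟩ := (mem_copy G₀).1 hΓ1
    exact psi_le G₀ hp f _ Finset.inter_subset_left hΓ2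
  · have : (UU M).card ≤ (k + (m + 1)) * G₀.edgeFinset.card := by
      refine (Finset.card_union_le _ _).trans ?_
      have := card_biUnion G₀ M hM
      rw [add_mul]; omega
    gcongr
    norm_num

lemma S_bound {n : ℕ} {p : ℝ} (hp : 0 < p) (hpsi : 0 < PsiMin G₀ n p) (W : Finset (Sym2 (Fin n)))
    (k : ℕ) (hW : W.card ≤ k * G₀.edgeFinset.card) (m : ℕ) :
    S G₀ n p W (m + 1) ≤ S G₀ n p W 1 *
      (((Fintype.card V₀).factorial *
        ((n : ℝ) ^ Fintype.card V₀ * p ^ G₀.edgeFinset.card) /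
          (Nat.card (G₀ ≃g G₀) * PsiMin G₀ n p)) ^ m *
        2 ^ ((∑ i ∈ Finset.range m, (k + (i + 1))) * G₀.edgeFinset.card)) := by
  induction m with
  | zero => simp
  | succ m ih =>
    refine (S_succ G₀ hp hpsi W k hW m).trans ?_
    refine (mul_le_mul_of_nonneg_right ih (by positivity)).trans (le_of_eq ?_)
    rw [Finset.sum_range_succ, add_mul, pow_add, pow_succ]
    ring

end S16

/-- for `m, m̂ ≥ 1` and `m̄ = m + m̂`,
`∑_{M, M̂} p^{|⋃_{Γ∈M∪M̂} Γ|} ≤ c_{m̄} · n^{m̄·v_{G₀}} · p^{m̄·e_{G₀}} / (Ψ_min^{m̄−2}·min{Ψ_min,1})`,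
the sum running over all pairs of a set of connected copies `M` of size `m` and a set of
connected copies `M̂` of size `m̂`, with
`c_{m̄} = (v_{G₀}!)^{m̄−1} · 2^{(1/2)m̄(m̄−1)e_{G₀}} · aut(G₀)^{−m̄}`. -/
theorem stmt_16 {V₀ : Type*} [Fintype V₀] [DecidableEq V₀]
    (G₀ : SimpleGraph V₀) [DecidableRel G₀.Adj]
    (hedge : G₀.edgeFinset.Nonempty)
    (hniso : ∀ v : V₀, ∃ w, G₀.Adj v w)
    (n : ℕ) (p : ℝ) (hp : 0 < p) (hp1 : p < 1)
    (m m' : ℕ) (hm : 1 ≤ m) (hm' : 1 ≤ m') :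
    ∑ M ∈ connCopies G₀ n m, ∑ M' ∈ connCopies G₀ n m',
        p ^ ((Finset.univ.biUnion M ∪ Finset.univ.biUnion M').card) ≤
      ((Fintype.card V₀).factorial : ℝ) ^ (m + m' - 1) *
          2 ^ ((m + m') * (m + m' - 1) / 2 * G₀.edgeFinset.card) /
          (Nat.card (G₀ ≃g G₀) : ℝ) ^ (m + m') *
        ((n : ℝ) ^ ((m + m') * Fintype.card V₀) * p ^ ((m + m') * G₀.edgeFinset.card) /
          (PsiMin G₀ n p ^ (m + m' - 2) * min (PsiMin G₀ n p) 1)) := by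
  rcases Nat.eq_zero_or_pos n with rfl | hn
  · have hcard : 0 < Fintype.card V₀ := by
      obtain ⟨e, _⟩ := hedge
      induction e using Sym2.ind with
      | _ x y => exact Fintype.card_pos_iff.2 ⟨x⟩
    have hemp : connCopies G₀ 0 m = ∅ := by
      refine Finset.eq_empty_of_forall_notMem fun M hM => ?_
      obtain ⟨f, _⟩ := (S16.mem_copy G₀).1 ((Finset.mem_filter.1 hM).2.1 ⟨0, hm⟩)
      have := Fintype.card_le_of_embedding f
      simp at this; simp [this] at hcard
    have h0 : (((0 : ℕ) : ℝ)) ^ ((m + m') * Fintype.card V₀) = 0 := by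
      rw [Nat.cast_zero]; exact zero_pow (Nat.mul_pos (by omega) hcard).ne'
    rw [hemp, h0]; simp
  have hpsi := S16.psi_pos G₀ hp hn hedge
  have hA : (0 : ℝ) < Nat.card (G₀ ≃g G₀) := by exact_mod_cast S16.aut_pos G₀
  obtain ⟨a, rfl⟩ : ∃ a, m = a + 1 := ⟨m - 1, by omega⟩
  obtain ⟨b, rfl⟩ : ∃ b, m' = b + 1 := ⟨m' - 1, by omega⟩
  set Ψ := PsiMin G₀ n p with hΨ
  set A : ℝ := ((Nat.card (G₀ ≃g G₀) : ℕ) : ℝ) with hAdef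
  set e := G₀.edgeFinset.card with he
  set v := Fintype.card V₀ with hv
  set X : ℝ := (n : ℝ) ^ v * p ^ e with hX
  have hXp : 0 < X := by positivity
  have hmin : 0 < min Ψ 1 := lt_min hpsi one_pos
  set C : ℝ := (v.factorial : ℝ) * X / (A * Ψ) with hC
  have hCp : 0 ≤ C := by positivity
  have inner : ∀ M ∈ connCopies G₀ n (a + 1), ∑ M' ∈ connCopies G₀ n (b + 1),
        p ^ ((Finset.univ.biUnion M ∪ Finset.univ.biUnion M').card) ≤
      p ^ (Finset.univ.biUnion M).card * ((v.factorial : ℝ) * 2 ^ ((a + 1) * e) * X / (A * min Ψ 1)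
        * (C ^ b * 2 ^ ((∑ i ∈ Finset.range b, (a + 1 + (i + 1))) * e))) := by
    intro M hM
    have hW := S16.card_biUnion G₀ M hM
    refine (S16.S_bound G₀ hp hpsi _ (a + 1) hW b).trans ?_
    rw [S16.S_one, mul_assoc (p ^ _)]
    refine mul_le_mul_of_nonneg_left ?_ (by positivity)
    refine mul_le_mul_of_nonneg_right ?_ (by positivity)
    refine (S16.step G₀ hp (Finset.univ.biUnion M) _ subset_rfl (min Ψ 1) hmin ?_).trans ?_
    · intro Γ hΓ
      rcases Finset.eq_empty_or_nonempty (Γ ∩ Finset.univ.biUnion M) with h | h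
      · rw [h]
        simp [S16.vert]
      · obtain ⟨f, rfl⟩ := (S16.mem_copy G₀).1 hΓ
        exact (min_le_left _ _).trans (S16.psi_le G₀ hp f _ Finset.inter_subset_left h)
    · gcongr
      norm_num
  refine (Finset.sum_le_sum inner).trans ?_
  rw [← Finset.sum_mul]
  have outer : ∑ M ∈ connCopies G₀ n (a + 1), p ^ (Finset.univ.biUnion M).card ≤
      X / A * (C ^ a * 2 ^ ((∑ i ∈ Finset.range a, (0 + (i + 1))) * e)) := by
    have h := S16.S_bound G₀ hp hpsi ∅ 0 (by simp) a
    have h1 : S16.S G₀ n p ∅ (a + 1) = ∑ M ∈ connCopies G₀ n (a + 1),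
        p ^ (Finset.univ.biUnion M).card := by
      unfold S16.S; simp only [Finset.empty_union]
    rw [← h1]
    refine h.trans ?_
    refine mul_le_mul_of_nonneg_right ?_ (by positivity)
    rw [S16.S_one]
    simpa using S16.step_zero G₀ (n := n) hp
  refine (mul_le_mul_of_nonneg_right outer (by positivity)).trans (le_of_eq ?_)
  have hexp : (a + 1 + (b + 1)) * (a + 1 + (b + 1) - 1) / 2 =
      (∑ i ∈ Finset.range a, (0 + (i + 1))) + (a + 1) +
        ∑ i ∈ Finset.range b, (a + 1 + (i + 1)) := by
    rw [← Finset.sum_range_id_mul_two, Nat.mul_div_cancel _ two_pos,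
      show a + 1 + (b + 1) = (a + 1) + 1 + b by ring, Finset.sum_range_add,
      Finset.sum_range_succ, Finset.sum_range_succ']
    simp only [zero_add, add_zero]
    congr 1
    exact Finset.sum_congr rfl fun i _ => by ring
  rw [hexp, show a + 1 + (b + 1) - 1 = a + b + 1 by omega,
    show a + 1 + (b + 1) - 2 = a + b by omega, mul_comm (a + 1 + (b + 1)) v,
    mul_comm (a + 1 + (b + 1)) e, pow_mul (n : ℝ), pow_mul p, ← mul_pow, ← hX, hC]
  rw [add_mul (_ + _) (∑ i ∈ Finset.range b, (a + 1 + (i + 1))),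
    add_mul (∑ i ∈ Finset.range a, (0 + (i + 1))) (a + 1), pow_add (2 : ℝ), pow_add (2 : ℝ)]
  generalize (2 : ℝ) ^ ((∑ i ∈ Finset.range a, (0 + (i + 1))) * e) = t1
  generalize (2 : ℝ) ^ ((∑ i ∈ Finset.range b, (a + 1 + (i + 1))) * e) = t2
  generalize (2 : ℝ) ^ ((a + 1) * e) = t3
  generalize hμ : min Ψ 1 = μ at *
  have := hpsi.ne'
  have := hmin.ne'
  have := hA.ne'
  simp only [div_pow, mul_pow, pow_add, pow_one]
  field_simp
end
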